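/- For every positive integer n, the number of maximal sum-free subsets of [n] satisfies f_max(n) ≥ 2^{⌊n/4⌋}. -/

import Mathlib

/-- A set of naturals is sum-free: no `x, y ∈ S` (not necessarily distinct) with `x + y ∈ S`. -/
def SumFree (S : Finset ℕ) : Prop := ∀ x ∈ S, ∀ y ∈ S, x + y ∉ S

/-- `S` is a maximal sum-free subset of `[n] = {1, …, n}`. -/
def IsMaxSumFree (n : ℕ) (S : Finset ℕ) : Prop :=
  S ⊆ Finset.Icc 1 n ∧ SumFree S ∧
    ∀ T : Finset ℕ, T ⊆ Finset.Icc 1 n → SumFree T → S ⊆ T → S = T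

/-- The number of maximal sum-free subsets of `[n]`. -/
noncomputable def fmax (n : ℕ) : ℕ := {S : Finset ℕ | IsMaxSumFree n S}.ncard

/-- Every sum-free subset of `[n]` is contained in a maximal one. -/
theorem SumFree.exists_isMaxSumFree {n : ℕ} {S : Finset ℕ} (hS : S ⊆ Finset.Icc 1 n)
    (hfree : SumFree S) : ∃ T, S ⊆ T ∧ IsMaxSumFree n T := by
  have hfin : {T : Finset ℕ | T ⊆ Finset.Icc 1 n ∧ SumFree T}.Finite :=
    (Finset.finite_toSet (Finset.Icc 1 n).powerset).subset fun _ hT => Finset.mem_powerset.2 hT.1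
  obtain ⟨T, hST, hT⟩ := hfin.exists_le_maximal (a := S) ⟨hS, hfree⟩
  exact ⟨T, hST, hT.prop.1, hT.prop.2, fun U hU hUfree hTU =>
    Finset.Subset.antisymm hTU (hT.le_of_ge ⟨hU, hUfree⟩ hTU)⟩

theorem finite_setOf_isMaxSumFree (n : ℕ) : {S : Finset ℕ | IsMaxSumFree n S}.Finite :=
  (Finset.finite_toSet (Finset.Icc 1 n).powerset).subset fun _ hT => Finset.mem_powerset.2 hT.1

open Classical in
/-- The elements of `[n]` that are `4 * k`, or the element of a pair
`{2 * i + 1, 4 * k - (2 * i + 1)}`, `i < k`, selected by `A`: the smaller one if `i ∈ A` and the larger one otherwise. -/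
noncomputable def pairChoice (n k : ℕ) (A : Finset ℕ) : Finset ℕ :=
  (Finset.Icc 1 n).filter fun z =>
    z = 4 * k ∨ ∃ i < k, (i ∈ A ∧ z = 2 * i + 1) ∨ (i ∉ A ∧ z + (2 * i + 1) = 4 * k)

theorem mem_pairChoice {n k : ℕ} {A : Finset ℕ} {z : ℕ} :
    z ∈ pairChoice n k A ↔ (1 ≤ z ∧ z ≤ n) ∧
      (z = 4 * k ∨ ∃ i < k, (i ∈ A ∧ z = 2 * i + 1) ∨ (i ∉ A ∧ z + (2 * i + 1) = 4 * k)) := by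
  simp [pairChoice]

theorem sumFree_pairChoice (n k : ℕ) (A : Finset ℕ) : SumFree (pairChoice n k A) := by
  intro x hx y hy hxy
  rw [mem_pairChoice] at hx hy hxy
  obtain ⟨hx0, rfl | ⟨i, hi, ⟨hiA, hxi⟩ | ⟨hiA, hxi⟩⟩⟩ := hx <;>
  obtain ⟨hy0, hy | ⟨j, hj, ⟨hjA, hyj⟩ | ⟨hjA, hyj⟩⟩⟩ := hy <;>
  obtain ⟨-, h | ⟨l, hl, ⟨-, h⟩ | ⟨-, h⟩⟩⟩ := hxy <;>
  first
  | omega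
  | (have hij : i = j := by omega
     subst hij
     contradiction)

theorem mem_iff_of_pairChoice_subset {n k : ℕ} (hkn : 4 * k ≤ n) {A T : Finset ℕ}
    (hAT : pairChoice n k A ⊆ T) (hT : SumFree T) {i : ℕ} (hi : i < k) :
    i ∈ A ↔ 2 * i + 1 ∈ T := by
  refine ⟨fun hiA => hAT (mem_pairChoice.2 ⟨by omega, .inr ⟨i, hi, .inl ⟨hiA, rfl⟩⟩⟩),
    fun hiT => by_contra fun hiA => ?_⟩
  have h₁ : 4 * k ∈ T := hAT (mem_pairChoice.2 ⟨by omega, .inl rfl⟩)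
  have h₂ : 4 * k - (2 * i + 1) ∈ T :=
    hAT (mem_pairChoice.2 ⟨by omega, .inr ⟨i, hi, .inr ⟨hiA, by omega⟩⟩⟩)
  refine hT _ hiT _ h₂ ?_
  rwa [Nat.add_sub_cancel' (by omega)]

theorem stmt1 (n : ℕ) (hn : 0 < n) : 2 ^ (n / 4) ≤ fmax n := by
  have hkn : 4 * (n / 4) ≤ n := Nat.mul_div_le n 4
  choose T hST hT using fun A : Finset ℕ =>
    (sumFree_pairChoice n (n / 4) A).exists_isMaxSumFree (Finset.filter_subset _ _)
  have hinj : Set.InjOn T ((Finset.range (n / 4)).powerset : Set (Finset ℕ)) := by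
    intro A hA B hB hAB
    simp only [Finset.coe_powerset, Set.mem_preimage, Set.mem_powerset_iff,
      Finset.coe_subset] at hA hB
    have key : ∀ i < n / 4, (i ∈ A ↔ i ∈ B) := fun i hi => by
      rw [mem_iff_of_pairChoice_subset hkn (hST A) (hT A).2.1 hi,
        mem_iff_of_pairChoice_subset hkn (hST B) (hT B).2.1 hi, hAB]
    ext i
    exact ⟨fun h => (key i (Finset.mem_range.1 (hA h))).1 h,
      fun h => (key i (Finset.mem_range.1 (hB h))).2 h⟩
  calc 2 ^ (n / 4) = ((Finset.range (n / 4)).powerset : Set (Finset ℕ)).ncard := by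
        rw [Set.ncard_coe_finset, Finset.card_powerset, Finset.card_range]
    _ ≤ fmax n := Set.ncard_le_ncard_of_injOn T (fun A _ => hT A) hinj
        (finite_setOf_isMaxSumFree n)
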